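/- arXiv:1512.03043 — 3 statements merged into one kernel-verified Lean document; each statement's English description precedes it below -/
import Mathlib

section
/- Let n = 2 and let c_o > 0. There exists c > 0, depending only on c_o and σ, such that the following holds: if u : ℝ² → ℝ is locally integrable, E ⊆ ℝ² is measurable, u ≥ 0 a.e. on E and u ≤ 0 a.e. on Eᶜ, u = ũ a.e. outside B_1, the function u − ũ (extended by 0 outside B_1) has a square-integrable weak gradient on all of ℝ², and the weak gradient G of u on B_1 satisfies ∫_{B_1} ‖G‖² dx ≤ c_o, then Per_σ(E, B_1) ≥ c. -/
open MeasureTheory Filter Set Metric Bornology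
open scoped ENNReal Topology symmDiff

noncomputable section

abbrev Pt (n : ℕ) : Type := EuclideanSpace ℝ (Fin n)

/-- The interaction functional `L(A,B) = ∫_A ∫_B |x-y|^{-(n+σ)} dy dx`. -/
def interL (n : ℕ) (σ : ℝ) (A B : Set (Pt n)) : ℝ≥0∞ :=
  ∫⁻ x in A, ∫⁻ y in B, ENNReal.ofReal (‖x - y‖ ^ (-((n : ℝ) + σ)))

/-- The fractional `σ`-perimeter of `E` in `D`. -/
def fracPer (n : ℕ) (σ : ℝ) (E D : Set (Pt n)) : ℝ≥0∞ :=
  interL n σ (E ∩ D) Eᶜ + interL n σ (Eᶜ ∩ D) (E ∩ Dᶜ)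

/-- `u` (locally integrable) has weak gradient `G` on the open set `U`. -/
def HasWeakGradOn (n : ℕ) (u : Pt n → ℝ) (G : Pt n → Pt n) (U : Set (Pt n)) : Prop :=
  LocallyIntegrableOn G U volume ∧
  ∀ (i : Fin n) (φ : Pt n → ℝ), ContDiff ℝ (⊤ : ℕ∞) φ → HasCompactSupport φ →
    tsupport φ ⊆ U →
    ∫ x, u x * fderiv ℝ φ x (EuclideanSpace.single i 1) = -∫ x, G x i * φ x

/-- The zero-extension (by `0` outside `Ω`) of `w` has a square-integrable weak
gradient on all of `ℝⁿ`. -/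
def ZeroExtGradL2 (n : ℕ) (Ω : Set (Pt n)) (w : Pt n → ℝ) : Prop :=
  ∃ H : Pt n → Pt n,
    HasWeakGradOn n (Ω.indicator w) H Set.univ ∧
    Integrable (fun x => ‖H x‖ ^ 2) volume

/-- An admissible pair `(u,E)` in `Ω`, with `G` a weak gradient of `u` on `Ω`. -/
structure AdmissiblePair (n : ℕ) (σ : ℝ) (Ω : Set (Pt n)) (u : Pt n → ℝ)
    (G : Pt n → Pt n) (E : Set (Pt n)) : Prop where
  locInt : LocallyIntegrable u volume
  weakGrad : HasWeakGradOn n u G Ω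
  dirichletFin : IntegrableOn (fun x => ‖G x‖ ^ 2) Ω volume
  measE : MeasurableSet E
  perFin : fracPer n σ E Ω ≠ ∞
  nonnegOnE : ∀ᵐ x ∂(volume : Measure (Pt n)), x ∈ E → 0 ≤ u x
  nonposOffE : ∀ᵐ x ∂(volume : Measure (Pt n)), x ∉ E → u x ≤ 0

/-- The energy functional `E_Ω(u,E)` (with `G` the weak gradient of `u` on `Ω`). -/
def energyF (n : ℕ) (σ : ℝ) (Φ : ℝ → ℝ) (Ω : Set (Pt n)) (G : Pt n → Pt n)
    (E : Set (Pt n)) : ℝ :=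
  (∫ x in Ω, ‖G x‖ ^ 2) + Φ ((fracPer n σ E Ω).toReal)

/-- `(u,E)`, with weak gradient `G`, minimizes the energy in `Ω` among admissible
competitors with the same exterior data. -/
def MinimizesIn (n : ℕ) (σ : ℝ) (Φ : ℝ → ℝ) (Ω : Set (Pt n)) (u : Pt n → ℝ)
    (G : Pt n → Pt n) (E : Set (Pt n)) : Prop :=
  AdmissiblePair n σ Ω u G E ∧
  ∀ (v : Pt n → ℝ) (Gv : Pt n → Pt n) (F : Set (Pt n)),
    AdmissiblePair n σ Ω v Gv F →
    (∀ᵐ x ∂(volume : Measure (Pt n)), x ∉ Ω → v x = u x) →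
    ZeroExtGradL2 n Ω (fun x => v x - u x) →
    volume ((F \ Ω) ∆ (E \ Ω)) = 0 →
    energyF n σ Φ Ω G E ≤ energyF n σ Φ Ω Gv F

/-- `(u,E)` is a minimal pair in `Ω`. -/
def IsMinimalPair (n : ℕ) (σ : ℝ) (Φ : ℝ → ℝ) (Ω : Set (Pt n)) (u : Pt n → ℝ)
    (E : Set (Pt n)) : Prop :=
  ∃ G : Pt n → Pt n, MinimizesIn n σ Φ Ω u G E

/-- `ũ(x,y) = xy`. -/
def tildeU : Pt 2 → ℝ := fun p => p 0 * p 1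

/-- `Ẽ = {(x,y) : xy > 0}`. -/
def tildeE : Set (Pt 2) := {p : Pt 2 | 0 < p 0 * p 1}

/-- `∇ũ(x,y) = (y,x)`. -/
def tildeG : Pt 2 → Pt 2 := fun p => (WithLp.equiv 2 (Fin 2 → ℝ)).symm ![p 1, p 0]

/-- The precise representative `û` of a locally integrable function. -/
def preciseRep (n : ℕ) (u : Pt n → ℝ) (x : Pt n) : ℝ :=
  limsup (fun ε : ℝ => (volume (ball x ε)).toReal⁻¹ * ∫ y in ball x ε, u y)
    (𝓝[>] (0 : ℝ))

/-- Membership in the set `𝒰₀`. -/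
def memU0 (n : ℕ) (Ω : Set (Pt n)) (u : Pt n → ℝ) (p : Pt n) : Prop :=
  p ∈ Ω ∧ ∃ xs : ℕ → Pt n, (∀ k, xs k ∈ Ω) ∧ Tendsto xs atTop (𝓝 p) ∧
    Tendsto (fun k => preciseRep n u (xs k)) atTop (𝓝 (0 : ℝ))

end

/-- A lower bound for the interaction of subsets of the unit ball and of a surrounding annulus. -/
theorem le_interL_of_ball_of_annulus {n : ℕ} {σ : ℝ} (hσ : 0 < σ) {A B S T : Set (Pt n)}
    (hSA : S ⊆ A) (hTB : T ⊆ B) (hS : MeasurableSet S) (hT : MeasurableSet T)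
    (hS1 : ∀ x ∈ S, ‖x‖ < 1) (hT1 : ∀ y ∈ T, 1 < ‖y‖ ∧ ‖y‖ < 2) :
    ENNReal.ofReal ((3 : ℝ) ^ (-((n : ℝ) + σ))) * volume T * volume S ≤ interL n σ A B := by
  unfold interL
  refine le_trans ?_ (lintegral_mono_set hSA)
  rw [← setLIntegral_const]
  refine setLIntegral_mono' hS fun x hx => ?_
  refine le_trans ?_ (lintegral_mono_set hTB)
  rw [← setLIntegral_const]
  refine setLIntegral_mono' hT fun y hy => ?_
  have h1 := hS1 x hx
  obtain ⟨h2, h3⟩ := hT1 y hy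
  refine ENNReal.ofReal_le_ofReal (Real.rpow_le_rpow_of_nonpos ?_ ?_ ?_)
  · have := norm_sub_norm_le y x
    rw [norm_sub_rev] at this
    linarith
  · have := norm_sub_le x y
    linarith
  · have : (0 : ℝ) ≤ n := n.cast_nonneg
    linarith

/-- A pair of sets with positive measure in the annulus on either side of `E` bounds the
fractional perimeter of `E` in the unit ball from below. -/
theorem le_fracPer_ball_of_annulus {n : ℕ} {σ : ℝ} (hσ : 0 < σ) {E P N : Set (Pt n)}
    (hE : MeasurableSet E)
    (hP1 : ∀ y ∈ P, 1 < ‖y‖ ∧ ‖y‖ < 2) (hN1 : ∀ y ∈ N, 1 < ‖y‖ ∧ ‖y‖ < 2)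
    (hP : MeasurableSet P) (hN : MeasurableSet N)
    (hPE : ∀ᵐ x ∂(volume : Measure (Pt n)), x ∈ P → x ∈ E)
    (hNE : ∀ᵐ x ∂(volume : Measure (Pt n)), x ∈ N → x ∉ E) :
    ENNReal.ofReal ((3 : ℝ) ^ (-((n : ℝ) + σ))) * min (volume P) (volume N) *
      volume (ball (0 : Pt n) 1) ≤ fracPer n σ E (ball (0 : Pt n) 1) := by
  have hout : ∀ y : Pt n, 1 < ‖y‖ → y ∉ ball (0 : Pt n) 1 := fun y hy h => by
    rw [mem_ball_zero_iff] at h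
    linarith
  have hball : ∀ x ∈ ball (0 : Pt n) 1, ‖x‖ < 1 := fun x hx => mem_ball_zero_iff.1 hx
  have hPv : volume P ≤ volume (E ∩ P) :=
    measure_mono_ae (hPE.mono fun x hx h => ⟨hx h, h⟩)
  have hNv : volume N ≤ volume (Eᶜ ∩ N) :=
    measure_mono_ae (hNE.mono fun x hx h => ⟨hx h, h⟩)
  have h1 := le_interL_of_ball_of_annulus (σ := σ) hσ (Subset.refl (E ∩ ball (0 : Pt n) 1))
    (inter_subset_left : Eᶜ ∩ N ⊆ Eᶜ) (hE.inter measurableSet_ball) (hE.compl.inter hN)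
    (fun x hx => hball x hx.2) (fun y hy => hN1 y hy.2)
  have h2 := le_interL_of_ball_of_annulus (σ := σ) hσ (Subset.refl (Eᶜ ∩ ball (0 : Pt n) 1))
    (fun y hy => ⟨hy.1, hout y (hP1 y hy.2).1⟩ : E ∩ P ⊆ E ∩ (ball (0 : Pt n) 1)ᶜ)
    (hE.compl.inter measurableSet_ball) (hE.inter hP)
    (fun x hx => hball x hx.2) (fun y hy => hP1 y hy.2)
  have hsplit : volume (ball (0 : Pt n) 1) =
      volume (E ∩ ball (0 : Pt n) 1) + volume (Eᶜ ∩ ball (0 : Pt n) 1) := by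
    rw [inter_comm E, inter_comm Eᶜ, ← sdiff_eq, measure_inter_add_sdiff _ hE]
  rw [hsplit, mul_add]
  refine add_le_add (le_trans ?_ h1) (le_trans ?_ h2)
  · gcongr
    exact (min_le_right _ _).trans hNv
  · gcongr
    exact (min_le_left _ _).trans hPv

/-- lower bound on `Per_σ(E, B_1)` (Lemma 3.1). -/
theorem statement4 (σ : ℝ) (hσ : σ ∈ Set.Ioo (0 : ℝ) 1) (c_o : ℝ) (hc_o : 0 < c_o) :
    ∃ c : ℝ, 0 < c ∧
      ∀ (u : Pt 2 → ℝ) (E : Set (Pt 2)) (G : Pt 2 → Pt 2),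
        LocallyIntegrable u volume →
        MeasurableSet E →
        (∀ᵐ x ∂(volume : Measure (Pt 2)), x ∈ E → 0 ≤ u x) →
        (∀ᵐ x ∂(volume : Measure (Pt 2)), x ∉ E → u x ≤ 0) →
        (∀ᵐ x ∂(volume : Measure (Pt 2)), x ∉ ball (0 : Pt 2) 1 → u x = tildeU x) →
        ZeroExtGradL2 2 (ball (0 : Pt 2) 1) (fun x => u x - tildeU x) →
        HasWeakGradOn 2 u G (ball (0 : Pt 2) 1) →
        IntegrableOn (fun x => ‖G x‖ ^ 2) (ball (0 : Pt 2) 1) volume →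
        (∫ x in ball (0 : Pt 2) 1, ‖G x‖ ^ 2) ≤ c_o →
        ENNReal.ofReal c ≤ fracPer 2 σ E (ball (0 : Pt 2) 1) := by
  have hcont : Continuous tildeU := by unfold tildeU; fun_prop
  have hU : IsOpen {y : Pt 2 | 1 < ‖y‖ ∧ ‖y‖ < 2} :=
    (isOpen_lt continuous_const continuous_norm).inter
      (isOpen_lt continuous_norm continuous_const)
  let P : Set (Pt 2) := {y | 1 < ‖y‖ ∧ ‖y‖ < 2} ∩ {y | 0 < tildeU y}
  let N : Set (Pt 2) := {y | 1 < ‖y‖ ∧ ‖y‖ < 2} ∩ {y | tildeU y < 0}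
  have hPo : IsOpen P := hU.inter (isOpen_lt continuous_const hcont)
  have hNo : IsOpen N := hU.inter (isOpen_lt hcont continuous_const)
  have hnorm : ∀ a b : ℝ, a ^ 2 + b ^ 2 = 2 → 1 < ‖(!₂[a, b] : Pt 2)‖ ∧ ‖(!₂[a, b] : Pt 2)‖ < 2 := by
    intro a b h
    have : ‖(!₂[a, b] : Pt 2)‖ ^ 2 = 2 := by
      rw [EuclideanSpace.norm_sq_eq]; simpa [Fin.sum_univ_two] using h
    constructor <;> nlinarith [norm_nonneg (!₂[a, b] : Pt 2)]
  have hPne : P.Nonempty := ⟨!₂[1, 1], hnorm 1 1 (by norm_num), by simp [tildeU]⟩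
  have hNne : N.Nonempty := ⟨!₂[1, -1], hnorm 1 (-1) (by norm_num), by simp [tildeU]⟩
  have hPpos : 0 < volume P := hPo.measure_pos volume hPne
  have hNpos : 0 < volume N := hNo.measure_pos volume hNne
  have hPfin : volume P < ∞ := lt_of_le_of_lt
    (measure_mono fun y hy => mem_ball_zero_iff.2 hy.1.2) (measure_ball_lt_top (x := 0) (r := 2))
  have hBpos : 0 < volume (ball (0 : Pt 2) 1) := measure_ball_pos volume 0 one_pos
  have hkpos : 0 < ENNReal.ofReal ((3 : ℝ) ^ (-(((2 : ℕ) : ℝ) + σ))) :=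
    ENNReal.ofReal_pos.2 (by positivity)
  set C : ℝ≥0∞ := ENNReal.ofReal ((3 : ℝ) ^ (-(((2 : ℕ) : ℝ) + σ))) *
    min (volume P) (volume N) * volume (ball (0 : Pt 2) 1) with hC
  have hCpos : C ≠ 0 :=
    mul_ne_zero (mul_ne_zero hkpos.ne' (lt_min hPpos hNpos).ne') hBpos.ne'
  have hCfin : C ≠ ∞ :=
    ENNReal.mul_ne_top (ENNReal.mul_ne_top ENNReal.ofReal_ne_top
      ((min_le_left _ _).trans_lt hPfin).ne) measure_ball_lt_top.ne
  refine ⟨C.toReal, ENNReal.toReal_pos hCpos hCfin, ?_⟩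
  intro u E G _ hE hnonneg hnonpos hext _ _ _ _
  rw [ENNReal.ofReal_toReal hCfin]
  have hout : ∀ y : Pt 2, 1 < ‖y‖ → y ∉ ball (0 : Pt 2) 1 := fun y hy h => by
    rw [mem_ball_zero_iff] at h
    linarith
  refine le_fracPer_ball_of_annulus hσ.1 hE (fun y hy => hy.1) (fun y hy => hy.1)
    hPo.measurableSet hNo.measurableSet ?_ ?_
  · filter_upwards [hnonpos, hext] with x h1 h2 hx
    by_contra hxE
    have hpos : 0 < tildeU x := hx.2
    linarith [h1 hxE, h2 (hout x hx.1.1)]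
  · filter_upwards [hnonneg, hext] with x h1 h2 hx hxE
    have hneg : tildeU x < 0 := hx.2
    linarith [h1 hxE, h2 (hout x hx.1.1)]
end

section
/- Let n = 2, c_o > 0 and R > 0. There exists c > 0, depending only on c_o and σ (and not on R), such that the following holds: if u : ℝ² → ℝ is locally integrable, E ⊆ ℝ² is measurable, u ≥ 0 a.e. on E and u ≤ 0 a.e. on Eᶜ, u = ũ a.e. outside B_R, the function u − ũ (extended by 0 outside B_R) has a square-integrable weak gradient on all of ℝ², and the weak gradient G of u on B_R satisfies ∫_{B_R} ‖G‖² dx ≤ c_o R⁴, then Per_σ(E, B_R) ≥ c R^{2−σ}. -/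
open MeasureTheory Filter Set Metric Bornology
open scoped ENNReal Topology symmDiff

/-- If every point of `A` is within distance `r` of, and distinct from, every point of `D`, and
`D` is almost contained in `B`, then `L(A,B)` is at least `r^{-(n+σ)} |D| |A|`. -/
theorem le_interL_of_norm_sub_le {n : ℕ} {σ r : ℝ} (hσ : 0 ≤ σ) {A B D : Set (Pt n)}
    (hA : MeasurableSet A) (hD : MeasurableSet D)
    (hDB : D ≤ᵐ[(volume : Measure (Pt n))] B)
    (hr : ∀ x ∈ A, ∀ y ∈ D, x ≠ y ∧ ‖x - y‖ ≤ r) :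
    ENNReal.ofReal (r ^ (-((n : ℝ) + σ))) * volume D * volume A ≤ interL n σ A B := by
  rw [← setLIntegral_const]
  refine setLIntegral_mono' hA fun x hx => ?_
  rw [← setLIntegral_const]
  refine (setLIntegral_mono' hD fun y hy => ?_).trans (lintegral_mono_set' hDB)
  obtain ⟨hxy, hle⟩ := hr x hx y hy
  have hn : (0 : ℝ) ≤ n := n.cast_nonneg
  exact ENNReal.ofReal_le_ofReal <| Real.rpow_le_rpow_of_nonpos
    (norm_pos_iff.2 (sub_ne_zero.2 hxy)) hle (by linarith)

/-- Every point of the ball of radius `R` about `(s, t)`, where `|s| = |t| = 2R`, has coordinates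
of the same signs as `s` and `t`, and lies outside `B_R` but within `6R` of each point of `B_R`. -/
theorem mem_ball_corner {R s t : ℝ} (hs : |s| = 2 * R) (ht : |t| = 2 * R)
    {y : Pt 2} (hy : y ∈ ball (!₂[s, t] : Pt 2) R) :
    0 < s * y 0 ∧ 0 < t * y 1 ∧ y ∉ ball (0 : Pt 2) R ∧
      ∀ x ∈ ball (0 : Pt 2) R, x ≠ y ∧ ‖x - y‖ ≤ 6 * R := by
  have hR : 0 < R := pos_of_mem_ball hy
  rw [mem_ball, dist_eq_norm] at hy
  have h0 : |y 0 - s| < R := by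
    simpa using (PiLp.norm_apply_le (y - !₂[s, t]) 0).trans_lt hy
  have h1 : |y 1 - t| < R := by
    simpa using (PiLp.norm_apply_le (y - !₂[s, t]) 1).trans_lt hy
  have hy0 : |y 0| ≤ ‖y‖ := by simpa using PiLp.norm_apply_le y 0
  have hyR : y ∉ ball (0 : Pt 2) R := by
    rw [mem_ball_zero_iff, not_lt]
    have := abs_sub_abs_le_abs_sub s (y 0)
    rw [abs_sub_comm] at this
    linarith
  have pos {a b : ℝ} (ha : |a| = 2 * R) (hb : |b - a| < R) : 0 < a * b := by
    rw [abs_lt] at hb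
    rcases abs_cases a with h | h
    · exact mul_pos (by linarith) (by linarith)
    · exact mul_pos_of_neg_of_neg (by linarith) (by linarith)
  have hcorner : ‖(!₂[s, t] : Pt 2)‖ ≤ 4 * R := by
    rw [EuclideanSpace.norm_eq]
    refine Real.sqrt_le_iff.2 ⟨by linarith, ?_⟩
    simp only [Fin.sum_univ_two, Real.norm_eq_abs]
    simp only [Matrix.cons_val_zero, Matrix.cons_val_one, hs, ht]
    nlinarith
  refine ⟨pos hs h0, pos ht h1, hyR, fun x hx => ⟨fun h => hyR (h ▸ hx), ?_⟩⟩
  rw [mem_ball_zero_iff] at hx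
  have h2 : ‖x - y‖ ≤ ‖x‖ + ‖y‖ := norm_sub_le x y
  have h3 : ‖y‖ ≤ ‖y - !₂[s, t]‖ + ‖(!₂[s, t] : Pt 2)‖ := by
    simpa using norm_add_le (y - !₂[s, t]) !₂[s, t]
  linarith

/-- scaled lower bound on `Per_σ(E, B_R)` (Lemma 3.2). -/
theorem statement5 (σ : ℝ) (hσ : σ ∈ Set.Ioo (0 : ℝ) 1) (c_o : ℝ) (hc_o : 0 < c_o) :
    ∃ c : ℝ, 0 < c ∧
      ∀ R : ℝ, 0 < R →
      ∀ (u : Pt 2 → ℝ) (E : Set (Pt 2)) (G : Pt 2 → Pt 2),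
        LocallyIntegrable u volume →
        MeasurableSet E →
        (∀ᵐ x ∂(volume : Measure (Pt 2)), x ∈ E → 0 ≤ u x) →
        (∀ᵐ x ∂(volume : Measure (Pt 2)), x ∉ E → u x ≤ 0) →
        (∀ᵐ x ∂(volume : Measure (Pt 2)), x ∉ ball (0 : Pt 2) R → u x = tildeU x) →
        ZeroExtGradL2 2 (ball (0 : Pt 2) R) (fun x => u x - tildeU x) →
        HasWeakGradOn 2 u G (ball (0 : Pt 2) R) →
        IntegrableOn (fun x => ‖G x‖ ^ 2) (ball (0 : Pt 2) R) volume →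
        (∫ x in ball (0 : Pt 2) R, ‖G x‖ ^ 2) ≤ c_o * R ^ 4 →
        ENNReal.ofReal (c * R ^ ((2 : ℝ) - σ)) ≤ fracPer 2 σ E (ball (0 : Pt 2) R) := by
  obtain ⟨hσ0, -⟩ := hσ
  set v : ℝ := volume.real (ball (0 : Pt 2) 1) with hv
  have hv0 : 0 < v := ENNReal.toReal_pos (measure_ball_pos _ _ one_pos).ne' measure_ball_lt_top.ne
  refine ⟨6 ^ (-(((2 : ℕ) : ℝ) + σ)) * v * v, by positivity, ?_⟩
  intro R hR u E G _ hE hpos hneg hout _ _ _ _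
  have hvol (a : Pt 2) : volume (ball a R) = ENNReal.ofReal (R ^ 2 * v) := by
    rw [Measure.addHaar_ball volume a hR.le, ENNReal.ofReal_mul (by positivity), hv,
      ofReal_measureReal measure_ball_lt_top.ne]
    simp
  have hR2 : |2 * R| = 2 * R := abs_of_pos (by linarith)
  have hR2' : |-(2 * R)| = 2 * R := by rw [abs_neg, hR2]
  have hN : ball (!₂[2 * R, -(2 * R)] : Pt 2) R ≤ᵐ[(volume : Measure (Pt 2))] Eᶜ := by
    filter_upwards [hpos, hout] with y hp ho hy hyE
    obtain ⟨h0, h1, hyR, -⟩ := mem_ball_corner hR2 hR2' hy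
    have hu : 0 ≤ y 0 * y 1 := (hp hyE).trans_eq (ho hyR)
    have h0' : 0 < y 0 := pos_of_mul_pos_right h0 (by linarith)
    nlinarith
  have hP : ball (!₂[2 * R, 2 * R] : Pt 2) R ≤ᵐ[(volume : Measure (Pt 2))]
      (E ∩ (ball (0 : Pt 2) R)ᶜ : Set (Pt 2)) := by
    filter_upwards [hneg, hout] with y hn ho hy
    obtain ⟨h0, h1, hyR, -⟩ := mem_ball_corner hR2 hR2 hy
    refine ⟨by_contra fun hyE => ?_, hyR⟩
    have hu : y 0 * y 1 ≤ 0 := (ho hyR).symm.trans_le (hn hyE)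
    have h0' : 0 < y 0 := pos_of_mul_pos_right h0 (by linarith)
    nlinarith
  have hL1 := le_interL_of_norm_sub_le hσ0.le (hE.inter measurableSet_ball) measurableSet_ball hN
    fun x hx y hy => (mem_ball_corner hR2 hR2' hy).2.2.2 x hx.2
  have hL2 := le_interL_of_norm_sub_le hσ0.le (hE.compl.inter measurableSet_ball)
    measurableSet_ball hP fun x hx y hy => (mem_ball_corner hR2 hR2 hy).2.2.2 x hx.2
  refine le_trans (le_of_eq ?_) (add_le_add hL1 hL2)
  have hsplit : volume (E ∩ ball (0 : Pt 2) R) + volume (Eᶜ ∩ ball (0 : Pt 2) R)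
      = ENNReal.ofReal (R ^ 2 * v) := by
    rw [← hvol 0, inter_comm, inter_comm Eᶜ, ← sdiff_eq, measure_inter_add_sdiff _ hE]
  rw [hvol, hvol, ← mul_add, hsplit, ← ENNReal.ofReal_mul (by positivity),
    ← ENNReal.ofReal_mul (by positivity)]
  congr 1
  have hpow : R ^ ((2 : ℝ) - σ) = R ^ (-(((2 : ℕ) : ℝ) + σ)) * R ^ 4 := by
    rw [← Real.rpow_natCast R 4, ← Real.rpow_add hR]
    congr 1
    push_cast
    ring
  rw [hpow, Real.mul_rpow (by norm_num) hR.le]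
  ring
end

section
/- Let Ω' and Ω be open subsets of ℝⁿ with the closure of Ω' compact and contained in Ω. Let E, F ⊆ ℝⁿ be measurable sets with Per_σ(E,Ω) < ∞ and Per_σ(F,Ω) < ∞, and suppose that E\cl(Ω') = F\cl(Ω'), where cl(Ω') denotes the closure of Ω'. Then Per_σ(E, cl(Ω')) and Per_σ(F, cl(Ω')) are finite and Per_σ(E,Ω) + Per_σ(F, cl(Ω')) = Per_σ(F,Ω) + Per_σ(E, cl(Ω')) (equivalently, Per_σ(E,Ω) − Per_σ(F,Ω) = Per_σ(E, cl(Ω')) − Per_σ(F, cl(Ω'))). -/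
open MeasureTheory Filter Set Metric Bornology
open scoped ENNReal Topology symmDiff

theorem measurable_fracKernel (n : ℕ) (σ : ℝ) :
    Measurable (fun p : Pt n × Pt n => ENNReal.ofReal (‖p.1 - p.2‖ ^ (-((n : ℝ) + σ)))) := by
  fun_prop

theorem interL_comm (n : ℕ) (σ : ℝ) (A B : Set (Pt n)) :
    interL n σ A B = interL n σ B A := by
  unfold interL
  rw [lintegral_lintegral_swap (measurable_fracKernel n σ).aemeasurable]
  simp only [norm_sub_rev]

theorem interL_union_left (n : ℕ) (σ : ℝ) {A₁ A₂ : Set (Pt n)} (B : Set (Pt n))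
    (hA₂ : MeasurableSet A₂) (h : Disjoint A₁ A₂) :
    interL n σ (A₁ ∪ A₂) B = interL n σ A₁ B + interL n σ A₂ B :=
  lintegral_union hA₂ h

theorem interL_union_right (n : ℕ) (σ : ℝ) (A : Set (Pt n)) {B₁ B₂ : Set (Pt n)}
    (hB₂ : MeasurableSet B₂) (h : Disjoint B₁ B₂) :
    interL n σ A (B₁ ∪ B₂) = interL n σ A B₁ + interL n σ A B₂ := by
  simp only [interL_comm n σ A, interL_union_left n σ A hB₂ h]

/-- The perimeter in `D` is the perimeter in `K ⊆ D` plus the interactions across `E` that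
involve `D` but avoid `K`; the latter depend only on `E \ K`. -/
theorem fracPer_eq_add_of_subset (n : ℕ) (σ : ℝ) {E K D : Set (Pt n)}
    (hE : MeasurableSet E) (hK : MeasurableSet K) (hD : MeasurableSet D) (hKD : K ⊆ D) :
    fracPer n σ E D = fracPer n σ E K +
      (interL n σ ((E \ K) ∩ D) ((E \ K)ᶜ \ K) +
        interL n σ (((E \ K)ᶜ \ K) ∩ D) ((E \ K) ∩ Dᶜ)) := by
  have split_left : ∀ A : Set (Pt n), A ∩ D = (A ∩ K) ∪ ((A \ K) ∩ D) := by
    intro A; ext x; have := @hKD x; simp; tauto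
  have split_compl : Eᶜ = (Eᶜ ∩ K) ∪ (Eᶜ \ K) := (inter_union_sdiff Eᶜ K).symm
  have split_outer : E ∩ Kᶜ = ((E \ K) ∩ D) ∪ ((E \ K) ∩ Dᶜ) :=
    (inter_union_compl (E \ K) D).symm
  have compl_diff_eq : (E \ K)ᶜ \ K = Eᶜ \ K := by ext x; simp; tauto
  have outer_eq : (E \ K) ∩ Dᶜ = E ∩ Dᶜ := by
    ext x; have := @hKD x; simp; tauto
  have disj_left : ∀ A : Set (Pt n), Disjoint (A ∩ K) ((A \ K) ∩ D) := fun A =>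
    disjoint_left.2 fun x hx hx' => hx'.1.2 hx.2
  have first : interL n σ (E ∩ D) Eᶜ = interL n σ (E ∩ K) Eᶜ +
      (interL n σ ((E \ K) ∩ D) (Eᶜ ∩ K) + interL n σ ((E \ K) ∩ D) (Eᶜ \ K)) := by
    rw [split_left E, interL_union_left n σ _ ((hE.diff hK).inter hD) (disj_left E),
      ← interL_union_right n σ _ (hE.compl.diff hK)
        (disjoint_left.2 fun x hx hx' => hx'.2 hx.2), ← split_compl]
  have second : interL n σ (Eᶜ ∩ D) (E ∩ Dᶜ) = interL n σ (Eᶜ ∩ K) (E ∩ Dᶜ) +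
      interL n σ ((Eᶜ \ K) ∩ D) (E ∩ Dᶜ) := by
    rw [split_left Eᶜ, interL_union_left n σ _ ((hE.compl.diff hK).inter hD) (disj_left Eᶜ)]
  have third : interL n σ (Eᶜ ∩ K) (E ∩ Kᶜ) = interL n σ ((E \ K) ∩ D) (Eᶜ ∩ K) +
      interL n σ (Eᶜ ∩ K) (E ∩ Dᶜ) := by
    rw [split_outer, interL_union_right n σ _ ((hE.diff hK).inter hD.compl)
      (disjoint_left.2 fun x hx hx' => hx'.2 hx.2), outer_eq,
      interL_comm n σ (Eᶜ ∩ K) ((E \ K) ∩ D)]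
  rw [fracPer, fracPer, compl_diff_eq, outer_eq, first, second, third]
  ring


/-- the "clean cut" lemma (Lemma 2.2, fractional case). -/
theorem statement7 (n : ℕ) (hn : 1 ≤ n) (σ : ℝ) (hσ : σ ∈ Set.Ioo (0 : ℝ) 1)
    (Ω' Ω : Set (Pt n)) (hΩ'o : IsOpen Ω') (hΩo : IsOpen Ω)
    (hcpt : IsCompact (closure Ω')) (hsub : closure Ω' ⊆ Ω)
    (E F : Set (Pt n)) (hmE : MeasurableSet E) (hmF : MeasurableSet F)
    (hPE : fracPer n σ E Ω ≠ ∞) (hPF : fracPer n σ F Ω ≠ ∞)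
    (hEF : E \ closure Ω' = F \ closure Ω') :
    fracPer n σ E (closure Ω') ≠ ∞ ∧ fracPer n σ F (closure Ω') ≠ ∞ ∧
    fracPer n σ E Ω + fracPer n σ F (closure Ω') =
      fracPer n σ F Ω + fracPer n σ E (closure Ω') := by
  have hK : MeasurableSet (closure Ω') := isClosed_closure.measurableSet
  have hE := fracPer_eq_add_of_subset n σ hmE hK hΩo.measurableSet hsub
  have hF := fracPer_eq_add_of_subset n σ hmF hK hΩo.measurableSet hsub
  rw [← hEF] at hF
  refine ⟨ne_top_of_le_ne_top hPE (hE ▸ le_self_add),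
    ne_top_of_le_ne_top hPF (hF ▸ le_self_add), ?_⟩
  rw [hE, hF]
  ring
end
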